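/- arXiv:2407.07576 — 6 statements merged into one kernel-verified Lean document; each statement's English description precedes it below -/
import Mathlib

section
/- Let ξ ∈ ℝ³ with ξ ≠ 0 and let c = (c_{μν})_{0≤μ,ν≤3} be a symmetric 4×4 complex matrix satisfying (a) −|ξ|·c_{00} + i·Σ_{i=1}^{3} ξ_i c_{0i} = 0, (b) −|ξ|·c_{0j} + i·Σ_{i=1}^{3} ξ_i c_{ij} = 0 for every j ∈ {1,2,3}, and (c) c_{ij} = (1/3)·(Σ_{k=1}^{3} c_{kk})·δ_{ij} for all i,j ∈ {1,2,3}. Then c = 0 if and only if the spatial trace Σ_{k=1}^{3} c_{kk} equals 0. -/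
open scoped BigOperators

/-- For the algebraic system arising from the Shapiro–Lopatinskij conditions
(harmonic gauge plus linearised conformal-class condition) in the Euclidean model,
the amplitude matrix `c` vanishes iff its spatial trace vanishes.  Index `0` is the
normal direction; `i.succ : Fin 4` (for `i : Fin 3`) labels the spatial directions. -/
theorem stmt_1 (ξ : EuclideanSpace ℝ (Fin 3)) (hξ : ξ ≠ 0)
    (c : Matrix (Fin 4) (Fin 4) ℂ) (hc : c.IsSymm)
    (ha : -(‖ξ‖ : ℂ) * c 0 0 + Complex.I * ∑ i : Fin 3, (ξ i : ℂ) * c 0 i.succ = 0)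
    (hb : ∀ j : Fin 3, -(‖ξ‖ : ℂ) * c 0 j.succ
        + Complex.I * ∑ i : Fin 3, (ξ i : ℂ) * c i.succ j.succ = 0)
    (hcc : ∀ i j : Fin 3, c i.succ j.succ
        = (1 / 3 : ℂ) * (∑ k : Fin 3, c k.succ k.succ) * (if i = j then 1 else 0)) :
    c = 0 ↔ (∑ k : Fin 3, c k.succ k.succ) = 0 := by
  have hn : (‖ξ‖ : ℂ) ≠ 0 := by
    exact_mod_cast norm_ne_zero_iff.mpr hξ
  constructor
  · intro h
    simp [h]
  · intro h
    have h1 : ∀ i j : Fin 3, c i.succ j.succ = 0 := by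
      intro i j
      rw [hcc i j, h]
      ring
    have h2 : ∀ j : Fin 3, c 0 j.succ = 0 := by
      intro j
      have hj := hb j
      simp only [h1, mul_zero, Finset.sum_const_zero, add_zero] at hj
      exact (mul_eq_zero.mp hj).resolve_left (neg_ne_zero.mpr hn)
    have h3 : c 0 0 = 0 := by
      simp only [h2, mul_zero, Finset.sum_const_zero, add_zero] at ha
      exact (mul_eq_zero.mp ha).resolve_left (neg_ne_zero.mpr hn)
    ext μ ν
    refine Fin.cases ?_ (fun i => ?_) μ
    · refine Fin.cases ?_ (fun j => ?_) ν
      · exact h3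
      · exact h2 j
    · refine Fin.cases ?_ (fun j => ?_) ν
      · exact (hc.apply 0 i.succ).trans (h2 i)
      · exact h1 i j
end

section
/- Let ξ ∈ ℝ³ with ξ ≠ 0, let C₂ > 0 be a real number, and let S be a positive semidefinite symmetric real 3×3 matrix. Let c = (c_{μν})_{0≤μ,ν≤3} be a symmetric 4×4 complex matrix satisfying (a) −|ξ|·c_{00} + i·Σ_{i=1}^{3} ξ_i c_{0i} = 0, (b) −|ξ|·c_{0j} + i·Σ_{i=1}^{3} ξ_i c_{ij} = 0 for every j ∈ {1,2,3}, (c) c_{ij} = (1/3)·t·δ_{ij} for all i,j ∈ {1,2,3} where t := Σ_{k=1}^{3} c_{kk}, and additionally the scalar condition 2·C₂·|ξ|·t + Σ_{i,j=1}^{3} S_{ij}·(|ξ|·δ_{ij} − ξ_i ξ_j/|ξ|)·t = 0. Then c = 0. -/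
open scoped BigOperators

/-- The general conformal boundary conditions satisfy the
Shapiro–Lopatinskij ellipticity conditions in the Euclidean model: the harmonic-gauge
conditions (a), (b), the conformal-class condition (c), and the general first-order
scalar condition with coefficients `C₂ > 0` and positive semidefinite symmetric `S`
force the amplitude matrix `c` to vanish.  Index `0` is the normal direction;
`i.succ : Fin 4` (for `i : Fin 3`) labels the spatial directions. -/
theorem stmt_2 (ξ : EuclideanSpace ℝ (Fin 3)) (hξ : ξ ≠ 0)
    (C₂ : ℝ) (hC₂ : 0 < C₂)
    (S : Matrix (Fin 3) (Fin 3) ℝ) (hS : S.PosSemidef)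
    (c : Matrix (Fin 4) (Fin 4) ℂ) (hc : c.IsSymm)
    (ha : -(‖ξ‖ : ℂ) * c 0 0 + Complex.I * ∑ i : Fin 3, (ξ i : ℂ) * c 0 i.succ = 0)
    (hb : ∀ j : Fin 3, -(‖ξ‖ : ℂ) * c 0 j.succ
        + Complex.I * ∑ i : Fin 3, (ξ i : ℂ) * c i.succ j.succ = 0)
    (hcc : ∀ i j : Fin 3, c i.succ j.succ
        = (1 / 3 : ℂ) * (∑ k : Fin 3, c k.succ k.succ) * (if i = j then 1 else 0))
    (hd : (2 * C₂ * (‖ξ‖ : ℝ) : ℂ) * (∑ k : Fin 3, c k.succ k.succ)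
        + (∑ i : Fin 3, ∑ j : Fin 3,
            ((S i j * ((‖ξ‖ : ℝ) * (if i = j then 1 else 0) - ξ i * ξ j / ‖ξ‖) : ℝ) : ℂ))
          * (∑ k : Fin 3, c k.succ k.succ) = 0) :
    c = 0 := by
  have hn : 0 < ‖ξ‖ := norm_pos_iff.mpr hξ
  have hn2 : ‖ξ‖ ^ 2 = ξ 0 ^ 2 + ξ 1 ^ 2 + ξ 2 ^ 2 := by
    rw [EuclideanSpace.real_norm_sq_eq, Fin.sum_univ_three]
  have hnC : (‖ξ‖ : ℂ) ≠ 0 := by exact_mod_cast hn.ne'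
  have hsym : ∀ i j, S i j = S j i := fun i j => by
    simpa using (hS.1.apply i j).symm
  have h1 := hS.dotProduct_mulVec_nonneg ![ξ 1, -ξ 0, 0]
  have h2 := hS.dotProduct_mulVec_nonneg ![ξ 2, 0, -ξ 0]
  have h3 := hS.dotProduct_mulVec_nonneg ![0, ξ 2, -ξ 1]
  simp [dotProduct, Matrix.mulVec, Fin.sum_univ_three] at h1 h2 h3
  have hQ : 0 ≤ ∑ i : Fin 3, ∑ j : Fin 3,
      (S i j * ((‖ξ‖ : ℝ) * (if i = j then 1 else 0) - ξ i * ξ j / ‖ξ‖)) := by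
    have key : ∑ i : Fin 3, ∑ j : Fin 3,
        (S i j * ((‖ξ‖ : ℝ) * (if i = j then 1 else 0) - ξ i * ξ j / ‖ξ‖))
        = ((S 0 0 + S 1 1 + S 2 2) * ‖ξ‖ ^ 2
          - ∑ i : Fin 3, ∑ j : Fin 3, S i j * (ξ i * ξ j)) / ‖ξ‖ := by
      simp [Fin.sum_univ_three]
      field_simp
      ring
    rw [key, hn2]
    refine div_nonneg ?_ hn.le
    simp only [Fin.sum_univ_three]
    rw [hsym 1 0, hsym 2 0, hsym 2 1] at *
    nlinarith [h1, h2, h3]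
  have ht : ∑ k : Fin 3, c k.succ k.succ = 0 := by
    rw [← add_mul] at hd
    refine (mul_eq_zero.mp hd).resolve_left ?_
    have hpos := add_pos_of_pos_of_nonneg (mul_pos (mul_pos two_pos hC₂) hn) hQ
    exact_mod_cast hpos.ne'
  have hij : ∀ i j : Fin 3, c i.succ j.succ = 0 := fun i j => by
    rw [hcc, ht]; simp
  have h0 : ∀ j : Fin 3, c 0 j.succ = 0 := fun j => by
    have := hb j
    simpa [hij, hξ] using this
  have h00 : c 0 0 = 0 := by
    simpa [h0, hξ] using ha
  ext μ ν
  refine Fin.cases ?_ (fun i => ?_) μ <;> refine Fin.cases ?_ (fun j => ?_) ν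
  · simpa using h00
  · simpa using h0 j
  · rw [← hc.apply]; simpa using h0 i
  · simpa using hij i j
end

section
/- For smooth u : ℝ⁴ → Sym₄(ℝ), define (Pu)_{μν} = −Σ_λ ∂_λ∂_λ u_{μν} − (I(d(δu)))_{μν}. Then for all smooth compactly supported u, v : ℝ⁴ → Sym₄(ℝ), ∫_{ℝ⁴} Σ_{μ,ν=0}^{3} (Pu)_{μν}(x)·(Iv)_{μν}(x) dx = ∫_{ℝ⁴} Σ_{μ,ν=0}^{3} (Iu)_{μν}(x)·(Pv)_{μν}(x) dx; that is, P is formally self-adjoint with respect to the pairing (u,v) ↦ ∫ Σ_{μν} u_{μν}·(Iv)_{μν}. -/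
open scoped BigOperators

/-- Partial derivative `∂_μ f` of a scalar function on `ℝ⁴`. -/
noncomputable def pd (μ : Fin 4) (f : (Fin 4 → ℝ) → ℝ) : (Fin 4 → ℝ) → ℝ :=
  fun p => deriv (fun t => f (Function.update p μ t)) (p μ)

/-- The symmetrised gradient `(dω)_{μν} = (1/2)(∂_μ ω_ν + ∂_ν ω_μ)`. -/
noncomputable def symGrad (ω : (Fin 4 → ℝ) → Fin 4 → ℝ) :
    (Fin 4 → ℝ) → Matrix (Fin 4) (Fin 4) ℝ :=
  fun p => Matrix.of fun μ ν =>
    (1 / 2 : ℝ) * (pd μ (fun q => ω q ν) p + pd ν (fun q => ω q μ) p)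

/-- The flat trace reversal `I(v)_{μν} = v_{μν} − (1/2)(Σ_λ v_{λλ})δ_{μν}`. -/
noncomputable def traceRev (v : Matrix (Fin 4) (Fin 4) ℝ) : Matrix (Fin 4) (Fin 4) ℝ :=
  Matrix.of fun μ ν =>
    v μ ν - (1 / 2 : ℝ) * (∑ lam : Fin 4, v lam lam) * (if μ = ν then 1 else 0)

/-- The gauge operator `K = I ∘ d`. -/
noncomputable def Kop (ω : (Fin 4 → ℝ) → Fin 4 → ℝ) :
    (Fin 4 → ℝ) → Matrix (Fin 4) (Fin 4) ℝ :=
  fun p => traceRev (symGrad ω p)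

/-- The divergence `(δu)_μ = −2·Σ_λ ∂_λ u_{λμ}`. -/
noncomputable def divg (u : (Fin 4 → ℝ) → Matrix (Fin 4) (Fin 4) ℝ) :
    (Fin 4 → ℝ) → Fin 4 → ℝ :=
  fun p μ => -2 * ∑ lam : Fin 4, pd lam (fun q => u q lam μ) p

/-- The flat linearised Einstein operator
`(Pu)_{μν} = −Σ_λ ∂_λ∂_λ u_{μν} − (I(d(δu)))_{μν}`. -/
noncomputable def Pop (u : (Fin 4 → ℝ) → Matrix (Fin 4) (Fin 4) ℝ) :
    (Fin 4 → ℝ) → Matrix (Fin 4) (Fin 4) ℝ :=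
  fun p => Matrix.of fun μ ν =>
    -(∑ lam : Fin 4, pd lam (pd lam (fun q => u q μ ν)) p)
      - traceRev (symGrad (divg u) p) μ ν

open MeasureTheory

/-- Smooth compactly supported scalar functions. -/
def GoodFn (f : (Fin 4 → ℝ) → ℝ) : Prop :=
  ContDiff ℝ (⊤ : ℕ∞) f ∧ HasCompactSupport f

lemma pd_eq_fderiv {f : (Fin 4 → ℝ) → ℝ} (hf : Differentiable ℝ f) (μ : Fin 4) :
    pd μ f = fun p => fderiv ℝ f p (Pi.single μ 1) := by
  funext p
  have h1 : HasDerivAt (Function.update p μ) (Pi.single μ 1) (p μ) := hasDerivAt_update p μ (p μ)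
  have h2 : HasFDerivAt f (fderiv ℝ f p) (Function.update p μ (p μ)) := by
    rw [Function.update_eq_self]
    exact (hf p).hasFDerivAt
  exact (h2.comp_hasDerivAt (p μ) h1).deriv

lemma GoodFn.differentiable {f : (Fin 4 → ℝ) → ℝ} (hf : GoodFn f) : Differentiable ℝ f :=
  hf.1.differentiable (by simp)

lemma GoodFn.pd {f : (Fin 4 → ℝ) → ℝ} (hf : GoodFn f) (μ : Fin 4) : GoodFn (pd μ f) := by
  rw [pd_eq_fderiv hf.differentiable]
  refine ⟨(hf.1.fderiv_right (m := (⊤ : ℕ∞)) (by simp)).clm_apply contDiff_const, ?_⟩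
  exact hf.2.fderiv_apply ℝ _

lemma GoodFn.integrable_mul {f g : (Fin 4 → ℝ) → ℝ} (hf : GoodFn f) (hg : GoodFn g) :
    Integrable (fun x => f x * g x) :=
  (hf.1.continuous.mul hg.1.continuous).integrable_of_hasCompactSupport hf.2.mul_right

lemma GoodFn.ibp {f g : (Fin 4 → ℝ) → ℝ} (hf : GoodFn f) (hg : GoodFn g) (μ : Fin 4) :
    ∫ x, _root_.pd μ f x * g x = - ∫ x, f x * _root_.pd μ g x := by
  have h1 := (hf.pd μ).integrable_mul hg
  have h2 := hf.integrable_mul (hg.pd μ)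
  have h3 := hf.integrable_mul hg
  rw [pd_eq_fderiv hf.differentiable] at h1 ⊢
  rw [pd_eq_fderiv hg.differentiable] at h2 ⊢
  rw [integral_mul_fderiv_eq_neg_fderiv_mul_of_integrable h1 h2 h3
    (fun x _ => hf.differentiable x) (fun x _ => hg.differentiable x), neg_neg]

lemma pd_const_mul_sum {f : Fin 4 → (Fin 4 → ℝ) → ℝ} (hf : ∀ i, GoodFn (f i)) (c : ℝ) (μ : Fin 4)
    (p : Fin 4 → ℝ) :
    pd μ (fun q => c * ∑ i, f i q) p = c * ∑ i, pd μ (f i) p := by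
  have hd : ∀ i, Differentiable ℝ (f i) := fun i => (hf i).differentiable
  have hs : Differentiable ℝ (fun q => ∑ i, f i q) := by fun_prop
  rw [pd_eq_fderiv (hs.const_mul c)]
  simp only [fun i => pd_eq_fderiv (hd i) μ]
  rw [fderiv_const_mul (hs p), fderiv_fun_sum (fun i _ => hd i p)]
  simp

/-- The pointwise algebra: `L` stands for `∂∂u`, `w` for `v`. -/
lemma algebra_identity (D : Fin 4 → Fin 4 → Fin 4 → Fin 4 → ℝ) (w : Matrix (Fin 4) (Fin 4) ℝ)
    (hw : w.IsSymm) :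
    ∑ μ, ∑ ν, (-(∑ l, D l l μ ν) - traceRev (Matrix.of fun a b => (1 / 2 : ℝ) *
      ((-2) * ∑ l, D a l l b + (-2) * ∑ l, D b l l a)) μ ν) * traceRev w μ ν
    = ∑ μ, ∑ ν, ∑ l, (-(D l l μ ν * w μ ν) + (1 / 2) * (D l l μ μ * w ν ν)
        + 2 * (D μ l l ν * w μ ν)) := by
  have h10 := hw.apply 0 1
  have h20 := hw.apply 0 2
  have h30 := hw.apply 0 3
  have h21 := hw.apply 1 2
  have h31 := hw.apply 1 3
  have h32 := hw.apply 2 3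
  simp only [traceRev, Matrix.of_apply, Fin.sum_univ_four]
  simp [h10, h20, h30, h21, h31, h32]
  ring

lemma main_formula (u v : (Fin 4 → ℝ) → Matrix (Fin 4) (Fin 4) ℝ)
    (hu : ∀ μ ν : Fin 4, GoodFn (fun q => u q μ ν))
    (hv : ∀ μ ν : Fin 4, GoodFn (fun q => v q μ ν))
    (hvs : ∀ p, (v p).IsSymm) :
    ∫ x : Fin 4 → ℝ, ∑ μ : Fin 4, ∑ ν : Fin 4, Pop u x μ ν * traceRev (v x) μ ν
      = ∑ μ, ∑ ν, ∑ l,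
        ((∫ x, pd l (fun q => u q μ ν) x * pd l (fun q => v q μ ν) x)
          - (1 / 2) * (∫ x, pd l (fun q => u q μ μ) x * pd l (fun q => v q ν ν) x)
          - 2 * (∫ x, pd l (fun q => u q l ν) x * pd μ (fun q => v q μ ν) x)) := by
  have key : ∀ x, ∑ μ : Fin 4, ∑ ν : Fin 4, Pop u x μ ν * traceRev (v x) μ ν
      = ∑ μ, ∑ ν, ∑ l, (-(pd l (pd l (fun q => u q μ ν)) x * v x μ ν)
        + (1 / 2) * (pd l (pd l (fun q => u q μ μ)) x * v x ν ν)
        + 2 * (pd μ (pd l (fun q => u q l ν)) x * v x μ ν)) := by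
    intro x
    rw [← algebra_identity (fun a b c d => pd a (pd b (fun q => u q c d)) x) (v x) (hvs x)]
    have hdiv : ∀ a b, pd a (fun q => divg u q b) x
        = (-2) * ∑ l, pd a (pd l (fun q => u q l b)) x := fun a b =>
      pd_const_mul_sum (f := fun l => pd l (fun q => u q l b)) (fun l => (hu l b).pd l) (-2) a x
    simp only [Pop, symGrad, hdiv, Matrix.of_apply]
  simp only [key]
  have i1 : ∀ a b c d e f, Integrable (fun x => pd a (pd b (fun q => u q c d)) x * v x e f) :=
    fun a b c d e f => (((hu c d).pd b).pd a).integrable_mul (hv e f)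
  have i1neg : ∀ a b c d e f,
      Integrable (fun x => -(pd a (pd b (fun q => u q c d)) x * v x e f)) :=
    fun a b c d e f => (i1 a b c d e f).neg
  have i2 : ∀ μ ν l, Integrable (fun x => -(pd l (pd l (fun q => u q μ ν)) x * v x μ ν)
        + (1 / 2) * (pd l (pd l (fun q => u q μ μ)) x * v x ν ν)) := fun μ ν l =>
    (i1 _ _ _ _ _ _).neg.add ((i1 _ _ _ _ _ _).const_mul _)
  have i3 : ∀ μ ν l, Integrable (fun x => -(pd l (pd l (fun q => u q μ ν)) x * v x μ ν)
        + (1 / 2) * (pd l (pd l (fun q => u q μ μ)) x * v x ν ν)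
        + 2 * (pd μ (pd l (fun q => u q l ν)) x * v x μ ν)) := fun μ ν l =>
    (i2 μ ν l).add ((i1 _ _ _ _ _ _).const_mul _)
  rw [integral_finsetSum _ (fun μ _ => integrable_finsetSum _ fun ν _ =>
    integrable_finsetSum _ fun l _ => i3 μ ν l)]
  refine Finset.sum_congr rfl fun μ _ => ?_
  rw [integral_finsetSum _ (fun ν _ => integrable_finsetSum _ fun l _ => i3 μ ν l)]
  refine Finset.sum_congr rfl fun ν _ => ?_
  rw [integral_finsetSum _ (fun l _ => i3 μ ν l)]
  refine Finset.sum_congr rfl fun l _ => ?_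
  rw [integral_add (i2 μ ν l) ((i1 _ _ _ _ _ _).const_mul _),
    integral_add (i1neg _ _ _ _ _ _) ((i1 _ _ _ _ _ _).const_mul _),
    integral_neg, integral_const_mul, integral_const_mul,
    ((hu μ ν).pd l).ibp (hv μ ν) l, ((hu μ μ).pd l).ibp (hv ν ν) l,
    ((hu l ν).pd l).ibp (hv μ ν) μ]
  ring

lemma goodFn_entry {u : (Fin 4 → ℝ) → Matrix (Fin 4) (Fin 4) ℝ}
    (hu : ∀ μ ν : Fin 4, ContDiff ℝ (⊤ : ℕ∞) (fun q => u q μ ν))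
    (hcu : HasCompactSupport u) (μ ν : Fin 4) : GoodFn (fun q => u q μ ν) :=
  ⟨hu μ ν, hcu.comp_left (g := fun M : Matrix (Fin 4) (Fin 4) ℝ => M μ ν) rfl⟩

/-- The flat linearised Einstein operator `P` is formally self-adjoint
with respect to the pairing `(u,v) ↦ ∫ Σ_{μν} u_{μν}·(Iv)_{μν}`: for all smooth
compactly supported symmetric-matrix-valued `u, v` on `ℝ⁴`,
`∫ Σ_{μν} (Pu)_{μν}·(Iv)_{μν} = ∫ Σ_{μν} (Iu)_{μν}·(Pv)_{μν}`. -/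
theorem stmt_9 (u v : (Fin 4 → ℝ) → Matrix (Fin 4) (Fin 4) ℝ)
    (hu : ∀ μ ν : Fin 4, ContDiff ℝ (⊤ : ℕ∞) (fun q => u q μ ν))
    (hv : ∀ μ ν : Fin 4, ContDiff ℝ (⊤ : ℕ∞) (fun q => v q μ ν))
    (hus : ∀ p, (u p).IsSymm) (hvs : ∀ p, (v p).IsSymm)
    (hcu : HasCompactSupport u) (hcv : HasCompactSupport v) :
    ∫ x : Fin 4 → ℝ, ∑ μ : Fin 4, ∑ ν : Fin 4, Pop u x μ ν * traceRev (v x) μ ν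
      = ∫ x : Fin 4 → ℝ, ∑ μ : Fin 4, ∑ ν : Fin 4, traceRev (u x) μ ν * Pop v x μ ν := by
  have gu := goodFn_entry hu hcu
  have gv := goodFn_entry hv hcv
  have hcomm : ∀ x, ∑ μ : Fin 4, ∑ ν : Fin 4, traceRev (u x) μ ν * Pop v x μ ν
      = ∑ μ : Fin 4, ∑ ν : Fin 4, Pop v x μ ν * traceRev (u x) μ ν := fun x => by
    simp only [mul_comm]
  simp only [hcomm]
  rw [main_formula u v gu gv hvs, main_formula v u gv gu hus]
  have c : ∀ a b c d e f, ∫ x, pd a (fun q => v q b c) x * pd d (fun q => u q e f) x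
      = ∫ x, pd d (fun q => u q e f) x * pd a (fun q => v q b c) x := fun a b c d e f => by
    simp only [mul_comm]
  simp only [c, Finset.sum_sub_distrib]
  congr 1
  · congr 1
    rw [Finset.sum_comm]
  · simp only [Fin.sum_univ_four]
    ring
end

section
/- Let T ∈ ℝ and let ω : ℝ⁴ → ℝ⁴ be a smooth map with ω(p) = 0 at every point p with p₀ = T. Then u := Kω satisfies, at every point p with p₀ = T: u_{00}(p) = (1/2)·∂₀ω₀(p); u_{0i}(p) = (1/2)·∂₀ω_i(p) for every i ∈ {1,2,3}; u_{ij}(p) = −(1/2)·∂₀ω₀(p)·δ_{ij} for all i,j ∈ {1,2,3}; and consequently Σ_{k=1}^{3} u_{kk}(p) = −(3/2)·∂₀ω₀(p) and u_{ij}(p) = (1/3)·(Σ_{k=1}^{3} u_{kk}(p))·δ_{ij}, i.e. the tangential part of u on the hyperplane {p₀ = T} is pure trace. -/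
open scoped BigOperators

/-- Boundary relations for a gauge tensor `u = Kω` coming from a gauge
parameter `ω` vanishing on the boundary hyperplane `{p₀ = T}`.  In particular the
tangential part of `u` on the hyperplane is pure trace. -/
theorem stmt_10 (T : ℝ) (ω : (Fin 4 → ℝ) → Fin 4 → ℝ) (hω : ContDiff ℝ (⊤ : ℕ∞) ω)
    (hdir : ∀ p : Fin 4 → ℝ, p 0 = T → ω p = 0) :
    ∀ p : Fin 4 → ℝ, p 0 = T →
      Kop ω p 0 0 = (1 / 2 : ℝ) * pd 0 (fun q => ω q 0) p ∧
      (∀ i : Fin 3, Kop ω p 0 i.succ = (1 / 2 : ℝ) * pd 0 (fun q => ω q i.succ) p) ∧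
      (∀ i j : Fin 3, Kop ω p i.succ j.succ
        = -(1 / 2 : ℝ) * pd 0 (fun q => ω q 0) p * (if i = j then 1 else 0)) ∧
      (∑ k : Fin 3, Kop ω p k.succ k.succ) = -(3 / 2 : ℝ) * pd 0 (fun q => ω q 0) p ∧
      (∀ i j : Fin 3, Kop ω p i.succ j.succ
        = (1 / 3 : ℝ) * (∑ k : Fin 3, Kop ω p k.succ k.succ) * (if i = j then 1 else 0)) := by
  intro p hp
  have hz : ∀ (i : Fin 3) (ν : Fin 4), pd i.succ (fun q => ω q ν) p = 0 := by
    intro i ν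
    have h : (fun t => ω (Function.update p i.succ t) ν) = fun _ => (0 : ℝ) := by
      funext t
      rw [hdir _ (by rw [Function.update_of_ne (Fin.succ_ne_zero i).symm]; exact hp)]
      rfl
    simp only [pd, h, deriv_const]
  have htr : ∑ lam : Fin 4, symGrad ω p lam lam = pd 0 (fun q => ω q 0) p := by
    rw [Fin.sum_univ_succ]
    simp only [symGrad, Matrix.of_apply, hz]
    simp
    ring
  have h3 : ∀ i j : Fin 3, Kop ω p i.succ j.succ
      = -(1 / 2 : ℝ) * pd 0 (fun q => ω q 0) p * (if i = j then 1 else 0) := by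
    intro i j
    simp only [Kop, traceRev, Matrix.of_apply, htr, Fin.succ_inj]
    simp only [symGrad, Matrix.of_apply, hz]
    ring
  have h4 : (∑ k : Fin 3, Kop ω p k.succ k.succ) = -(3 / 2 : ℝ) * pd 0 (fun q => ω q 0) p := by
    simp only [h3, if_true, Finset.sum_const, Finset.card_univ, Fintype.card_fin, nsmul_eq_mul]
    push_cast
    ring
  refine ⟨?_, ?_, h3, h4, ?_⟩
  · simp only [Kop, traceRev, Matrix.of_apply, htr, if_true]
    simp only [symGrad, Matrix.of_apply]
    ring
  · intro i
    simp only [Kop, traceRev, Matrix.of_apply, htr, if_neg (Fin.succ_ne_zero i).symm]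
    simp only [symGrad, Matrix.of_apply, hz]
    ring
  · intro i j
    rw [h4, h3]
    ring
end

section
/- Let T ∈ ℝ and let ω : ℝ⁴ → ℝ⁴ be a smooth map such that ω(p) = 0 for every p with p₀ = T, and such that Σ_{λ=0}^{3} ∂_λ∂_λ ω_μ(p) = 0 for every μ ∈ {0,1,2,3} and every p with p₀ = T. Let u := Kω and t := Σ_{k=1}^{3} u_{kk}. Then for all real constants C₁, C₂, every vector V ∈ ℝ³ and every symmetric real 3×3 matrix S, the general scalar boundary condition holds at every point p with p₀ = T: C₁·(u_{00} + t/3)(p) + C₂·(∂₀t − ∂₀u_{00})(p) + Σ_{i=1}^{3} V_i·∂_i(u_{00} + t/3)(p) + Σ_{i,j=1}^{3} S_{ij}·(∂₀u_{ij} − ∂_i u_{0j} − ∂_j u_{0i} − δ_{ij}·∂₀u_{00})(p) = 0. -/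
open scoped BigOperators

theorem pd_eq {f : (Fin 4 → ℝ) → ℝ} (hf : ContDiff ℝ (⊤ : ℕ∞) f) (μ : Fin 4) (p : Fin 4 → ℝ) :
    pd μ f p = fderiv ℝ f p (Pi.single μ 1) := by
  have h1 : HasDerivAt (fun t => Function.update p μ t) (Pi.single μ (1 : ℝ)) (p μ) :=
    hasDerivAt_update p μ (p μ)
  have h2 : HasFDerivAt f (fderiv ℝ f p) (Function.update p μ (p μ)) := by
    rw [Function.update_eq_self]
    exact (hf.differentiable (by simp) p).hasFDerivAt
  exact (h2.comp_hasDerivAt (p μ) h1).deriv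

theorem pd_fun {f : (Fin 4 → ℝ) → ℝ} (hf : ContDiff ℝ (⊤ : ℕ∞) f) (μ : Fin 4) :
    pd μ f = fun p => fderiv ℝ f p (Pi.single μ 1) := funext (pd_eq hf μ)

theorem pd_smooth {f : (Fin 4 → ℝ) → ℝ} (hf : ContDiff ℝ (⊤ : ℕ∞) f) (μ : Fin 4) :
    ContDiff ℝ (⊤ : ℕ∞) (pd μ f) := by
  rw [pd_fun hf]
  exact (hf.fderiv_right (m := (⊤ : ℕ∞)) (by simp)).clm_apply contDiff_const

theorem pd_comm {f : (Fin 4 → ℝ) → ℝ} (hf : ContDiff ℝ (⊤ : ℕ∞) f) (μ ν : Fin 4)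
    (p : Fin 4 → ℝ) : pd μ (pd ν f) p = pd ν (pd μ f) p := by
  have hd : DifferentiableAt ℝ (fderiv ℝ f) p :=
    (hf.fderiv_right (m := (⊤ : ℕ∞)) (by simp)).differentiable (by simp) p
  have key : ∀ a b : Fin 4, pd a (pd b f) p
      = fderiv ℝ (fderiv ℝ f) p (Pi.single a 1) (Pi.single b 1) := by
    intro a b
    rw [pd_eq (pd_smooth hf b), pd_fun hf b, fderiv_clm_apply hd (by fun_prop)]
    simp
  rw [key, key]
  have hs : IsSymmSndFDerivAt ℝ f p :=
    (hf.contDiffAt).isSymmSndFDerivAt (by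
      rw [minSmoothness_of_isRCLikeNormedField]
      exact WithTop.coe_le_coe.2 le_top)
  exact hs _ _

theorem pd_add {f g : (Fin 4 → ℝ) → ℝ} (hf : ContDiff ℝ (⊤ : ℕ∞) f)
    (hg : ContDiff ℝ (⊤ : ℕ∞) g) (μ : Fin 4) (p : Fin 4 → ℝ) :
    pd μ (fun q => f q + g q) p = pd μ f p + pd μ g p := by
  rw [pd_eq (hf.add hg), pd_eq hf, pd_eq hg,
    fderiv_fun_add (hf.differentiable (by simp) p) (hg.differentiable (by simp) p)]
  rfl

theorem pd_cmul {f : (Fin 4 → ℝ) → ℝ} (hf : ContDiff ℝ (⊤ : ℕ∞) f)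
    (c : ℝ) (μ : Fin 4) (p : Fin 4 → ℝ) :
    pd μ (fun q => c * f q) p = c * pd μ f p := by
  rw [pd_eq (contDiff_const.mul hf), pd_eq hf,
    fderiv_const_mul (hf.differentiable (by simp) p)]
  rfl

theorem pd_sum {ι : Type} (s : Finset ι) {f : ι → (Fin 4 → ℝ) → ℝ}
    (hf : ∀ i, ContDiff ℝ (⊤ : ℕ∞) (f i)) (μ : Fin 4) (p : Fin 4 → ℝ) :
    pd μ (fun q => ∑ i ∈ s, f i q) p = ∑ i ∈ s, pd μ (f i) p := by
  rw [pd_eq (ContDiff.sum fun i _ => hf i),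
    fderiv_fun_sum (fun i _ => (hf i).differentiable (by simp) p)]
  simp [pd_eq (hf _)]

/-- Tangential derivatives of a function vanishing on the hyperplane vanish there. -/
theorem pd_tan {f : (Fin 4 → ℝ) → ℝ} {T : ℝ} (h : ∀ p : Fin 4 → ℝ, p 0 = T → f p = 0)
    (i : Fin 3) (p : Fin 4 → ℝ) (hp : p 0 = T) : pd i.succ f p = 0 := by
  have : (fun t => f (Function.update p i.succ t)) = fun _ => 0 := by
    funext t
    apply h
    rw [Function.update_of_ne (Fin.succ_ne_zero i).symm, hp]
  simp [pd, this]

theorem Kop_eq (ω : (Fin 4 → ℝ) → Fin 4 → ℝ) (μ ν : Fin 4) (q : Fin 4 → ℝ) :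
    Kop ω q μ ν = (1 / 2) * (pd μ (fun q => ω q ν) q + pd ν (fun q => ω q μ) q)
      + (-(1 / 2) * (if μ = ν then 1 else 0)) * ∑ l : Fin 4, pd l (fun q => ω q l) q := by
  have : ∀ x : ℝ, (1 / 2 : ℝ) * (x + x) = x := fun x => by ring
  simp only [Kop, traceRev, symGrad, Matrix.of_apply, this]
  ring

theorem Kop_smooth {ω : (Fin 4 → ℝ) → Fin 4 → ℝ} (hω : ContDiff ℝ (⊤ : ℕ∞) ω) (μ ν : Fin 4) :
    ContDiff ℝ (⊤ : ℕ∞) (fun q => Kop ω q μ ν) := by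
  have hW : ∀ a, ContDiff ℝ (⊤ : ℕ∞) (fun q => ω q a) := fun a => contDiff_pi.1 hω a
  simp only [Kop_eq]
  exact (contDiff_const.mul ((pd_smooth (hW _) _).add (pd_smooth (hW _) _))).add
    (contDiff_const.mul (ContDiff.sum fun i _ => pd_smooth (hW _) _))

theorem pd_Kop {ω : (Fin 4 → ℝ) → Fin 4 → ℝ} (hω : ContDiff ℝ (⊤ : ℕ∞) ω) (a μ ν : Fin 4)
    (p : Fin 4 → ℝ) :
    pd a (fun q => Kop ω q μ ν) p
      = (1 / 2) * (pd a (pd μ (fun q => ω q ν)) p + pd a (pd ν (fun q => ω q μ)) p)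
      + (-(1 / 2) * (if μ = ν then 1 else 0)) * ∑ l : Fin 4, pd a (pd l (fun q => ω q l)) p := by
  have hW : ∀ a, ContDiff ℝ (⊤ : ℕ∞) (fun q => ω q a) := fun a => contDiff_pi.1 hω a
  have hP : ∀ b a, ContDiff ℝ (⊤ : ℕ∞) (pd b (fun q => ω q a)) := fun b a => pd_smooth (hW a) b
  simp only [Kop_eq]
  rw [pd_add (contDiff_const.mul ((hP _ _).add (hP _ _)))
      (contDiff_const.mul (ContDiff.sum fun i _ => hP _ _)),
    pd_cmul ((hP _ _).add (hP _ _)), pd_add (hP _ _) (hP _ _),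
    pd_cmul (ContDiff.sum fun i _ => hP _ _), pd_sum _ (fun i => hP _ _)]

/-- Gauge invariance of the general first-order linear scalar boundary
condition (flat model): if the gauge parameter `ω` vanishes on the hyperplane
`{p₀ = T}` and is componentwise harmonic there, then `u = Kω` (with spatial trace
`t = Σ_k u_{kk}`) satisfies, for all constants `C₁, C₂`, all `V ∈ ℝ³` and all
symmetric real 3×3 matrices `S`, the scalar condition
`C₁(u₀₀ + t/3) + C₂(∂₀t − ∂₀u₀₀) + Σᵢ Vᵢ ∂ᵢ(u₀₀ + t/3)
  + Σᵢⱼ Sᵢⱼ (∂₀u_{ij} − ∂ᵢu_{0j} − ∂ⱼu_{0i} − δᵢⱼ ∂₀u₀₀) = 0` on the hyperplane. -/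
theorem stmt_13 (T : ℝ) (ω : (Fin 4 → ℝ) → Fin 4 → ℝ) (hω : ContDiff ℝ (⊤ : ℕ∞) ω)
    (hdir : ∀ p : Fin 4 → ℝ, p 0 = T → ω p = 0)
    (hharm : ∀ (μ : Fin 4) (p : Fin 4 → ℝ), p 0 = T →
      ∑ lam : Fin 4, pd lam (pd lam (fun q => ω q μ)) p = 0)
    (C₁ C₂ : ℝ) (V : Fin 3 → ℝ) (S : Matrix (Fin 3) (Fin 3) ℝ) (hS : S.IsSymm) :
    ∀ p : Fin 4 → ℝ, p 0 = T →
      C₁ * (Kop ω p 0 0 + (∑ k : Fin 3, Kop ω p k.succ k.succ) / 3)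
      + C₂ * (pd 0 (fun q => ∑ k : Fin 3, Kop ω q k.succ k.succ) p
          - pd 0 (fun q => Kop ω q 0 0) p)
      + (∑ i : Fin 3, V i *
          pd i.succ (fun q => Kop ω q 0 0 + (∑ k : Fin 3, Kop ω q k.succ k.succ) / 3) p)
      + (∑ i : Fin 3, ∑ j : Fin 3, S i j *
          (pd 0 (fun q => Kop ω q i.succ j.succ) p
            - pd i.succ (fun q => Kop ω q 0 j.succ) p
            - pd j.succ (fun q => Kop ω q 0 i.succ) p
            - (if i = j then 1 else 0) * pd 0 (fun q => Kop ω q 0 0) p)) = 0 := by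
  intro p hp
  have hW : ∀ a, ContDiff ℝ (⊤ : ℕ∞) (fun q => ω q a) := fun a => contDiff_pi.1 hω a
  have h0 : ∀ a (q : Fin 4 → ℝ), q 0 = T → ω q a = 0 := fun a q hq => by rw [hdir q hq]; rfl
  have h1 : ∀ (i : Fin 3) a (q : Fin 4 → ℝ), q 0 = T → pd i.succ (fun q => ω q a) q = 0 :=
    fun i a q hq => pd_tan (h0 a) i q hq
  have h2 : ∀ (i j : Fin 3) a, pd i.succ (pd j.succ (fun q => ω q a)) p = 0 :=
    fun i j a => pd_tan (h1 j a) i p hp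
  have h00 : ∀ a, pd 0 (pd 0 (fun q => ω q a)) p = 0 := by
    intro a
    have := hharm a p hp
    rw [Fin.sum_univ_succ] at this
    simpa [h2] using this
  have hA : ∀ q : Fin 4 → ℝ, q 0 = T →
      Kop ω q 0 0 + (∑ k : Fin 3, Kop ω q k.succ k.succ) / 3 = 0 := by
    intro q hq
    simp only [Kop_eq, Fin.sum_univ_succ (n := 3), h1 _ _ q hq, if_true]
    simp
    ring
  have hV : ∀ i : Fin 3, pd i.succ
      (fun q => Kop ω q 0 0 + (∑ k : Fin 3, Kop ω q k.succ k.succ) / 3) p = 0 :=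
    fun i => pd_tan hA i p hp
  have hC : pd 0 (fun q => ∑ k : Fin 3, Kop ω q k.succ k.succ) p
      - pd 0 (fun q => Kop ω q 0 0) p = 0 := by
    rw [pd_sum _ (fun k => Kop_smooth hω _ _)]
    simp only [pd_Kop hω, Fin.sum_univ_succ (n := 3), h00, if_true, Fin.sum_univ_three]
    ring
  have hSt : ∀ i j : Fin 3, pd 0 (fun q => Kop ω q i.succ j.succ) p
            - pd i.succ (fun q => Kop ω q 0 j.succ) p
            - pd j.succ (fun q => Kop ω q 0 i.succ) p
            - (if i = j then 1 else 0) * pd 0 (fun q => Kop ω q 0 0) p = 0 := by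
    intro i j
    simp only [pd_Kop hω, Fin.sum_univ_succ (n := 3), h00, h2, if_true, Fin.succ_inj,
      (Fin.succ_ne_zero _).symm, if_false, pd_comm (hW _) (Fin.succ _) 0]
    ring
  rw [hA p hp, hC]
  simp only [hV, hSt, mul_zero, Finset.sum_const_zero, add_zero]
end

section
/- Let h : ℝ⁴ → Sym₄(ℝ) be a smooth map into symmetric 4×4 real matrices and let p ∈ ℝ⁴. For λ ∈ ℝ, let ĝ(λ)(x) := Id₄ + λ·h(x) (invertible for all x near p and all λ small enough), and define the mean curvature of the slices {x₀ = const} with respect to ĝ(λ) by H(λ)(x) := Σ_{i,j=1}^{3} (ĝ(λ)⁻¹)_{ij}(x) · Γ̂⁰_{ij}(λ)(x) · ((ĝ(λ)⁻¹)_{00}(x))^{−1/2}, where Γ̂⁰_{ij}(λ) := (1/2)·Σ_{μ=0}^{3} (ĝ(λ)⁻¹)_{0μ}·(∂_i ĝ(λ)_{μj} + ∂_j ĝ(λ)_{μi} − ∂_μ ĝ(λ)_{ij}). Then λ ↦ H(λ)(p) is differentiable at λ = 0 with d/dλ|_{λ=0} H(λ)(p) = Σ_{i=1}^{3} ∂_i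 h_{0i}(p) − (1/2)·∂₀(Σ_{i=1}^{3} h_{ii})(p). -/
open scoped BigOperators

/-- The perturbed metric `ĝ(λ)(x) = Id₄ + λ·h(x)`. -/
noncomputable def ghat (h : (Fin 4 → ℝ) → Matrix (Fin 4) (Fin 4) ℝ) (lam : ℝ) :
    (Fin 4 → ℝ) → Matrix (Fin 4) (Fin 4) ℝ :=
  fun x => 1 + lam • h x

/-- The Christoffel symbol `Γ̂⁰_{ij}(λ)` of `ĝ(λ)` for spatial indices `i, j`. -/
noncomputable def christoffel (h : (Fin 4 → ℝ) → Matrix (Fin 4) (Fin 4) ℝ) (lam : ℝ)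
    (i j : Fin 3) : (Fin 4 → ℝ) → ℝ :=
  fun x => (1 / 2 : ℝ) * ∑ μ : Fin 4, (ghat h lam x)⁻¹ 0 μ *
    (pd i.succ (fun q => ghat h lam q μ j.succ) x
      + pd j.succ (fun q => ghat h lam q μ i.succ) x
      - pd μ (fun q => ghat h lam q i.succ j.succ) x)

/-- The mean curvature of the slices `{x₀ = const}` with respect to `ĝ(λ)`:
`H(λ) = Σ_{ij} (ĝ(λ)⁻¹)_{ij}·Γ̂⁰_{ij}(λ)·((ĝ(λ)⁻¹)₀₀)^(−1/2)`. -/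
noncomputable def meanCurv (h : (Fin 4 → ℝ) → Matrix (Fin 4) (Fin 4) ℝ) (lam : ℝ) :
    (Fin 4 → ℝ) → ℝ :=
  fun x => ∑ i : Fin 3, ∑ j : Fin 3,
    (ghat h lam x)⁻¹ i.succ j.succ * christoffel h lam i j x *
      ((ghat h lam x)⁻¹ 0 0) ^ (-(1 / 2) : ℝ)

lemma pd_ghat (h : (Fin 4 → ℝ) → Matrix (Fin 4) (Fin 4) ℝ) (lam : ℝ) (μ a b : Fin 4)
    (p : Fin 4 → ℝ) :
    pd μ (fun q => ghat h lam q a b) p = lam * pd μ (fun q => h q a b) p := by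
  simp only [pd, ghat, Matrix.add_apply, Matrix.smul_apply, smul_eq_mul]
  rw [deriv_const_add, deriv_const_mul_field]

lemma ghat_zero (h : (Fin 4 → ℝ) → Matrix (Fin 4) (Fin 4) ℝ) (p : Fin 4 → ℝ) :
    ghat h 0 p = 1 := by simp [ghat]

lemma cont_inv (h : (Fin 4 → ℝ) → Matrix (Fin 4) (Fin 4) ℝ) (p : Fin 4 → ℝ) (a b : Fin 4) :
    ContinuousAt (fun lam : ℝ => (ghat h lam p)⁻¹ a b) 0 := by
  have hc : Continuous (fun lam : ℝ => ghat h lam p) := by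
    unfold ghat
    exact continuous_const.add (continuous_id.smul continuous_const)
  simp only [Matrix.inv_def, Ring.inverse_eq_inv', Matrix.smul_apply, smul_eq_mul]
  refine ContinuousAt.mul (ContinuousAt.inv₀ hc.matrix_det.continuousAt ?_) ?_
  · simp [ghat_zero]
  · exact (hc.matrix_adjugate.matrix_elem a b).continuousAt

lemma hasDerivAt_mul_self (F : ℝ → ℝ) (hF : ContinuousAt F 0) :
    HasDerivAt (fun x => x * F x) (F 0) 0 := by
  rw [hasDerivAt_iff_tendsto_slope]
  refine (hF.tendsto.mono_left nhdsWithin_le_nhds).congr' ?_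
  filter_upwards [self_mem_nhdsWithin] with x hx
  have hx : x ≠ 0 := hx
  simp [slope_def_field, hx]

lemma pd_sum_s14 (h : (Fin 4 → ℝ) → Matrix (Fin 4) (Fin 4) ℝ)
    (hsmooth : ∀ μ ν : Fin 4, ContDiff ℝ (⊤ : ℕ∞) (fun q => h q μ ν)) (p : Fin 4 → ℝ) :
    pd 0 (fun q => ∑ i : Fin 3, h q i.succ i.succ) p
      = ∑ i : Fin 3, pd 0 (fun q => h q i.succ i.succ) p := by
  unfold pd
  refine deriv_fun_sum fun i _ => ?_
  have h1 : Differentiable ℝ (fun q => h q i.succ i.succ) :=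
    (hsmooth i.succ i.succ).differentiable (by simp)
  exact (h1 _).comp (p 0) (hasDerivAt_update p 0 (p 0)).differentiableAt

/-- The mean curvature divided by the parameter. -/
noncomputable def redCurv (h : (Fin 4 → ℝ) → Matrix (Fin 4) (Fin 4) ℝ) (p : Fin 4 → ℝ)
    (lam : ℝ) : ℝ :=
  ∑ i : Fin 3, ∑ j : Fin 3,
    (ghat h lam p)⁻¹ i.succ j.succ * ((1 / 2 : ℝ) * ∑ μ : Fin 4, (ghat h lam p)⁻¹ 0 μ *
    (pd i.succ (fun q => h q μ j.succ) p
      + pd j.succ (fun q => h q μ i.succ) p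
      - pd μ (fun q => h q i.succ j.succ) p)) *
      ((ghat h lam p)⁻¹ 0 0) ^ (-(1 / 2) : ℝ)

lemma meanCurv_eq (h : (Fin 4 → ℝ) → Matrix (Fin 4) (Fin 4) ℝ) (p : Fin 4 → ℝ) (lam : ℝ) :
    meanCurv h lam p = lam * redCurv h p lam := by
  simp only [meanCurv, redCurv, christoffel, pd_ghat, Finset.mul_sum, Finset.sum_mul]
  refine Finset.sum_congr rfl fun i _ => Finset.sum_congr rfl fun j _ =>
    Finset.sum_congr rfl fun μ _ => ?_
  ring

lemma redCurv_cont (h : (Fin 4 → ℝ) → Matrix (Fin 4) (Fin 4) ℝ) (p : Fin 4 → ℝ) :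
    ContinuousAt (redCurv h p) 0 := by
  unfold redCurv
  refine tendsto_finsetSum _ fun i _ => tendsto_finsetSum _ fun j _ => ?_
  refine ContinuousAt.mul (ContinuousAt.mul (cont_inv h p _ _) (continuousAt_const.mul
    (tendsto_finsetSum _ fun μ _ => (cont_inv h p 0 μ).mul continuousAt_const)))
    ((cont_inv h p 0 0).rpow_const (Or.inl ?_))
  simp [ghat_zero]

/-- Linearisation of Anderson's fixed-mean-curvature boundary condition
on a Euclidean background: for a smooth symmetric-matrix-valued perturbation `h`, the
mean curvature `H(λ)` of the slices `{x₀ = const}` with respect to `ĝ(λ) = Id + λh`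
satisfies `d/dλ|₀ H(λ)(p) = Σᵢ ∂ᵢ h₀ᵢ(p) − (1/2)·∂₀(Σᵢ hᵢᵢ)(p)`. -/
theorem stmt_14 (h : (Fin 4 → ℝ) → Matrix (Fin 4) (Fin 4) ℝ)
    (hsmooth : ∀ μ ν : Fin 4, ContDiff ℝ (⊤ : ℕ∞) (fun q => h q μ ν))
    (hsym : ∀ x, (h x).IsSymm) (p : Fin 4 → ℝ) :
    HasDerivAt (fun lam : ℝ => meanCurv h lam p)
      ((∑ i : Fin 3, pd i.succ (fun q => h q 0 i.succ) p)
        - (1 / 2 : ℝ) * pd 0 (fun q => ∑ i : Fin 3, h q i.succ i.succ) p) 0 := by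
  have key := hasDerivAt_mul_self _ (redCurv_cont h p)
  have e : (fun lam : ℝ => meanCurv h lam p) = fun lam => lam * redCurv h p lam :=
    funext (meanCurv_eq h p)
  rw [e]
  convert key using 1
  rw [pd_sum_s14 h hsmooth]
  simp only [redCurv, ghat_zero, inv_one]
  simp [Matrix.one_apply, Fin.sum_univ_succ]
  ring
end
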